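/- Let R be a terminating TRS. R is confluent if and only if every prime critical pair of R is joinable, where a critical pair arising from a critical peak t ←[p] s →[ε] u is prime if all proper subterms of s|p are in R-normal form. -/

import Mathlib

/-- First-order terms over a signature `F` with natural-number variables. -/
inductive Tm (F : Type) : Type
  | var : Nat → Tm F
  | fn  : F → List (Tm F) → Tm F

namespace Tm

variable {F : Type}

mutual
def subst (σ : Nat → Tm F) : Tm F → Tm F
  | .var n => σ n
  | .fn f ts => .fn f (substList σ ts)
def substList (σ : Nat → Tm F) : List (Tm F) → List (Tm F)
  | [] => []
  | t :: ts => subst σ t :: substList σ ts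
end

mutual
def varsList : Tm F → List Nat
  | .var n => [n]
  | .fn _ ts => varsListL ts
def varsListL : List (Tm F) → List Nat
  | [] => []
  | t :: ts => varsList t ++ varsListL ts
end

/-- The set of variables of a term. -/
def vars (t : Tm F) : Set Nat := {n | n ∈ varsList t}

/-- A term is linear if no variable occurs more than once. -/
def Linear (t : Tm F) : Prop := (varsList t).Nodup

/-- The subterm at a given position (if the position exists). -/
def subtermAt : Tm F → List Nat → Option (Tm F)
  | t, [] => some t
  | .var _, _ :: _ => none
  | .fn _ ts, i :: p =>
    match ts[i]? with
    | some u => subtermAt u p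
    | none => none
  termination_by t p => p.length

/-- Replacement of the subterm at a given position. -/
def replaceAt : Tm F → List Nat → Tm F → Option (Tm F)
  | _, [], s => some s
  | .var _, _ :: _, _ => none
  | .fn f ts, i :: p, s =>
    match ts[i]? with
    | some u => (replaceAt u p s).map fun u' => .fn f (ts.set i u')
    | none => none
  termination_by t p _ => p.length

end Tm

open Tm

/-- A term rewrite system (or equational system): a set of pairs of terms. -/
abbrev TRS (F : Type) := Set (Tm F × Tm F)

/-- Well-formedness of the rules: left-hand sides are not variables and
variables of right-hand sides occur on the left. -/
def IsTRS {F : Type} (R : TRS F) : Prop :=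
  ∀ p ∈ R, (∀ n, p.1 ≠ .var n) ∧ vars p.2 ⊆ vars p.1

def LeftLinear {F : Type} (R : TRS F) : Prop := ∀ p ∈ R, Linear p.1

/-- One-step rewrite relation of a set of rules (closed under contexts and
substitutions). -/
def Rew {F : Type} (R : TRS F) (s t : Tm F) : Prop :=
  ∃ p l r σ, (l, r) ∈ R ∧ subtermAt s p = some (subst σ l) ∧
    replaceAt s p (subst σ r) = some t

/-- Normal forms. -/
def NF {A : Type} (r : A → A → Prop) (a : A) : Prop := ∀ b, ¬ r a b

/-- The equational theory `∼B` generated by an ES `B`. -/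
def simE {F : Type} (B : TRS F) : Tm F → Tm F → Prop :=
  Relation.EqvGen (Rew B)

/-- Rewriting modulo: `∼B · →R · ∼B`. -/
def RewMod {F : Type} (R B : TRS F) (s t : Tm F) : Prop :=
  ∃ s' t', simE B s s' ∧ Rew R s' t' ∧ simE B t' t

def Terminating {F : Type} (R : TRS F) : Prop :=
  WellFounded (fun a b => Rew R b a)

def TerminatingMod {F : Type} (R B : TRS F) : Prop :=
  WellFounded (fun a b => RewMod R B b a)

/-- Conversion modulo `B`: arbitrary sequences of `→R`, `←R` and `∼B` steps. -/
def ConvMod {F : Type} (R B : TRS F) : Tm F → Tm F → Prop :=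
  Relation.ReflTransGen (fun a b => Rew R a b ∨ Rew R b a ∨ simE B a b)

/-- Joinability modulo `B` using the plain rewrite relation:
`→R* · ∼B · ←R*`. -/
def JoinMod {F : Type} (R B : TRS F) (s t : Tm F) : Prop :=
  ∃ u v, Relation.ReflTransGen (Rew R) s u ∧ simE B u v ∧
    Relation.ReflTransGen (Rew R) t v

def ChurchRosserMod {F : Type} (R B : TRS F) : Prop :=
  ∀ s t, ConvMod R B s t → JoinMod R B s t

def Joinable {F : Type} (R : TRS F) (s t : Tm F) : Prop :=
  ∃ v, Relation.ReflTransGen (Rew R) s v ∧ Relation.ReflTransGen (Rew R) t v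

def Confluent {F : Type} (R : TRS F) : Prop :=
  ∀ s t u, Relation.ReflTransGen (Rew R) s t → Relation.ReflTransGen (Rew R) s u →
    Joinable R t u

/-- Renaming a term by a bijection on variables. -/
def rename {F : Type} (ρ : Nat ≃ Nat) (t : Tm F) : Tm F :=
  subst (fun n => .var (ρ n)) t

def VariantTm {F : Type} (s t : Tm F) : Prop := ∃ ρ : Nat ≃ Nat, rename ρ s = t

def VariantRule {F : Type} (p q : Tm F × Tm F) : Prop :=
  ∃ ρ : Nat ≃ Nat, rename ρ p.1 = q.1 ∧ rename ρ p.2 = q.2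

def Unifies {F : Type} (σ : Nat → Tm F) (s t : Tm F) : Prop := subst σ s = subst σ t

/-- Most general unifier. -/
def IsMGU {F : Type} (σ : Nat → Tm F) (s t : Tm F) : Prop :=
  Unifies σ s t ∧ ∀ τ, Unifies τ s t → ∃ δ, ∀ n, τ n = subst δ (σ n)

/-- `CriticalPeak R₁ R₂ t p s u` : `t ←R₁[p] s →R₂[ε] u` is a critical peak
obtained from an overlap of variable-disjoint variants of rules of `R₁`
(inner rule) and `R₂` (root rule). -/
def CriticalPeak {F : Type} (R₁ R₂ : TRS F) (t : Tm F) (p : List Nat) (s u : Tm F) :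
    Prop :=
  ∃ l₁ r₁ l₂ r₂ σ,
    (∃ q ∈ R₁, VariantRule q (l₁, r₁)) ∧
    (∃ q ∈ R₂, VariantRule q (l₂, r₂)) ∧
    (vars l₁ ∪ vars r₁) ∩ (vars l₂ ∪ vars r₂) = ∅ ∧
    (∃ f ts, subtermAt l₂ p = some (.fn f ts) ∧ IsMGU σ l₁ (.fn f ts)) ∧
    (p = [] → ¬ VariantRule (l₁, r₁) (l₂, r₂)) ∧
    s = subst σ l₂ ∧
    replaceAt s p (subst σ r₁) = some t ∧
    u = subst σ r₂

/-- The set of critical pairs between `R₁` and `R₂`. -/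
def CP {F : Type} (R₁ R₂ : TRS F) : Set (Tm F × Tm F) :=
  {tu | ∃ p s, CriticalPeak R₁ R₂ tu.1 p s tu.2}

/-- A critical peak `t ←[p] s →[ε] u` is prime (w.r.t. `R`) if all proper
subterms of `s|p` are in normal form w.r.t. `→R`. -/
def PrimeAt {F : Type} (R : TRS F) (s : Tm F) (p : List Nat) : Prop :=
  ∀ q v, q ≠ [] → subtermAt s (p ++ q) = some v → NF (Rew R) v

/-- Prime critical pairs of a TRS. -/
def PCP {F : Type} (R : TRS F) : Set (Tm F × Tm F) :=
  {tu | ∃ p s, CriticalPeak R R tu.1 p s tu.2 ∧ PrimeAt R s p}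

/-- `E ∪ E⁻¹`. -/
def sympm {F : Type} (E : TRS F) : TRS F :=
  E ∪ {q | ∃ p ∈ E, q = (p.2, p.1)}

/-- Prime critical pairs between `R` and `B^±` (in both directions), where
primality is always checked with respect to `→R`. -/
def PCPpm {F : Type} (R B : TRS F) : Set (Tm F × Tm F) :=
  {tu | ∃ p s, (CriticalPeak R (sympm B) tu.1 p s tu.2 ∨
                CriticalPeak (sympm B) R tu.1 p s tu.2) ∧ PrimeAt R s p}

namespace Tm

variable {F : Type}

theorem ind {P : Tm F → Prop} (hvar : ∀ n, P (.var n))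
    (hfn : ∀ f ts, (∀ t ∈ ts, P t) → P (.fn f ts)) : ∀ t, P t
  | .var n => hvar n
  | .fn f ts => hfn f ts fun t _ => ind hvar hfn t
  termination_by t => sizeOf t

theorem substList_eq_map (σ : Nat → Tm F) (ts : List (Tm F)) :
    substList σ ts = ts.map (subst σ) := by
  induction ts with
  | nil => simp [substList]
  | cons t ts ih => simp [substList, ih]

@[simp] theorem subst_var (σ : Nat → Tm F) (n : Nat) : subst σ (.var n) = σ n := by
  simp [subst]

@[simp] theorem subst_fn (σ : Nat → Tm F) (f : F) (ts : List (Tm F)) :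
    subst σ (.fn f ts) = .fn f (ts.map (subst σ)) := by
  simp [subst, substList_eq_map]

@[simp] theorem mem_vars_var {m n : Nat} : m ∈ vars (.var n : Tm F) ↔ m = n := by
  simp [vars, varsList]

@[simp] theorem mem_vars_fn {m : Nat} {f : F} {ts : List (Tm F)} :
    m ∈ vars (.fn f ts) ↔ ∃ t ∈ ts, m ∈ vars t := by
  simp only [vars, varsList, Set.mem_ofPred_eq]
  induction ts with
  | nil => simp [varsListL]
  | cons t ts ih => simp [varsListL, ih]

theorem subst_subst (σ τ : Nat → Tm F) (t : Tm F) :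
    subst τ (subst σ t) = subst (fun n => subst τ (σ n)) t := by
  induction t using ind with
  | hvar n => simp
  | hfn f ts ih => simpa using ih

theorem subst_rename (τ : Nat → Tm F) (ρ : Nat ≃ Nat) (t : Tm F) :
    subst τ (rename ρ t) = subst (fun n => τ (ρ n)) t := by
  simp [rename, subst_subst]

theorem subst_eq_subst_iff {σ τ : Nat → Tm F} {t : Tm F} :
    subst σ t = subst τ t ↔ ∀ n ∈ vars t, σ n = τ n := by
  induction t using ind with
  | hvar n => simp
  | hfn f ts ih =>
    simp only [subst_fn, fn.injEq, true_and, List.map_inj_left, mem_vars_fn]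
    exact ⟨fun h n ⟨t, ht, hn⟩ => (ih t ht).1 (h t ht) n hn,
      fun h t ht => (ih t ht).2 fun n hn => h n ⟨t, ht, hn⟩⟩

theorem subst_var_eq (t : Tm F) : subst .var t = t := by
  induction t using ind with
  | hvar n => simp
  | hfn f ts ih => simpa using List.map_congr_left (g := id) ih

theorem mem_vars_rename {ρ : Nat ≃ Nat} {t : Tm F} {n : Nat} :
    n ∈ vars (rename ρ t) ↔ ∃ m ∈ vars t, n = ρ m := by
  unfold rename
  induction t using ind with
  | hvar k => simp
  | hfn f ts ih =>
    simp only [subst_fn, mem_vars_fn, List.mem_map, exists_exists_and_eq_and]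
    constructor
    · rintro ⟨t, ht, hn⟩
      obtain ⟨m, hm, rfl⟩ := (ih t ht).1 hn
      exact ⟨m, ⟨t, ht, hm⟩, rfl⟩
    · rintro ⟨m, ⟨t, ht, hm⟩, rfl⟩
      exact ⟨t, ht, (ih t ht).2 ⟨m, hm, rfl⟩⟩

theorem exists_vars_bound (t : Tm F) : ∃ N, ∀ n ∈ vars t, n < N :=
  ⟨(varsList t).sum + 1, fun _ hn => Nat.lt_succ_of_le (List.le_sum_of_mem hn)⟩

theorem sizeOf_lt_sizeOf_subst {τ : Nat → Tm F} {f : F} {ts : List (Tm F)} {n : Nat}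
    (hn : n ∈ vars (.fn f ts)) : sizeOf (τ n) < sizeOf (subst τ (.fn f ts)) := by
  have key : ∀ t : Tm F, n ∈ vars t → sizeOf (τ n) ≤ sizeOf (subst τ t) := by
    intro t
    induction t using ind with
    | hvar m => rintro h; simp_all
    | hfn g ss ih =>
      intro h
      obtain ⟨s, hs, h⟩ := mem_vars_fn.1 h
      have := List.sizeOf_lt_of_mem (List.mem_map_of_mem (f := subst τ) hs)
      have := ih s hs h
      simp
      omega
  obtain ⟨s, hs, h⟩ := mem_vars_fn.1 hn
  have := List.sizeOf_lt_of_mem (List.mem_map_of_mem (f := subst τ) hs)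
  have := key s h
  simp
  omega

/-- Simultaneously unifiable lists of terms have a most general unifier. -/
theorem exists_mgu_list (τ : Nat → Tm F) : ∀ (k : Nat) (as bs : List (Tm F)),
    sizeOf (as.map (subst τ)) ≤ k → as.map (subst τ) = bs.map (subst τ) →
    ∃ σ : Nat → Tm F, as.map (subst σ) = bs.map (subst σ) ∧
      ∀ τ' : Nat → Tm F, as.map (subst τ') = bs.map (subst τ') →
        ∃ δ, ∀ n, τ' n = subst δ (σ n) := by
  intro k
  induction k with
  | zero => intro as bs hk; cases as <;> simp at hk
  | succ k ih =>
    have elim : ∀ (x : Nat) (t : Tm F) (as bs : List (Tm F)),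
        sizeOf ((Tm.var x :: as).map (subst τ)) ≤ k + 1 →
        (Tm.var x :: as).map (subst τ) = (t :: bs).map (subst τ) →
        ∃ σ : Nat → Tm F, (Tm.var x :: as).map (subst σ) = (t :: bs).map (subst σ) ∧
          ∀ τ' : Nat → Tm F, (Tm.var x :: as).map (subst τ') = (t :: bs).map (subst τ') →
            ∃ δ, ∀ n, τ' n = subst δ (σ n) := by
      intro x t as bs hk h
      simp only [List.map_cons, List.cons.injEq, subst_var, List.cons.sizeOf_spec] at hk h ⊢
      by_cases hx : x ∈ vars t
      · cases t with
        | var y =>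
          obtain rfl : x = y := by simpa using hx
          obtain ⟨σ, h1, h2⟩ := ih as bs (by omega) h.2
          exact ⟨σ, ⟨by simp, h1⟩, fun τ' h' => h2 τ' h'.2⟩
        | fn f ts =>
          have := sizeOf_lt_sizeOf_subst (τ := τ) hx
          rw [← h.1] at this
          omega
      · set ρ : Nat → Tm F := Function.update .var x t with hρ
        have abs : ∀ τ' : Nat → Tm F, τ' x = subst τ' t →
            (fun n => subst τ' (ρ n)) = τ' := by
          intro τ' h'
          funext n
          by_cases hn : n = x
          · subst hn; simp [hρ, h']
          · simp [hρ, hn]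
        have absL : ∀ τ' : Nat → Tm F, τ' x = subst τ' t → ∀ cs : List (Tm F),
            (cs.map (subst ρ)).map (subst τ') = cs.map (subst τ') := by
          intro τ' h' cs
          simp [Function.comp_def, subst_subst, abs τ' h']
        have hρt : subst ρ t = t := by
          conv_rhs => rw [← subst_var_eq t]
          rw [subst_eq_subst_iff]
          intro n hn
          have : n ≠ x := fun h => hx (h ▸ hn)
          simp [hρ, this]
        obtain ⟨σ, h1, h2⟩ := ih (as.map (subst ρ)) (bs.map (subst ρ))
          (by rw [absL τ h.1]; omega) (by rw [absL τ h.1, absL τ h.1, h.2])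
        refine ⟨fun n => subst σ (ρ n), ⟨?_, ?_⟩, ?_⟩
        · rw [← subst_subst, hρt]; simp [hρ]
        · simpa [Function.comp_def, subst_subst] using h1
        · intro τ' h'
          obtain ⟨δ, hδ⟩ := h2 τ' (by rw [absL τ' h'.1, absL τ' h'.1, h'.2])
          refine ⟨δ, fun n => ?_⟩
          rw [subst_subst, ← funext hδ]
          exact (congrFun (abs τ' h'.1) n).symm
    intro as bs hk h
    rcases as with _ | ⟨a, as⟩
    · obtain rfl : bs = [] := by simpa using h.symm
      exact ⟨.var, rfl, fun τ' _ => ⟨τ', by simp⟩⟩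
    rcases bs with _ | ⟨b, bs⟩
    · simp at h
    rcases a with x | ⟨f, ts⟩
    · exact elim x b as bs hk h
    rcases b with x | ⟨g, ss⟩
    · obtain ⟨σ, h1, h2⟩ := elim x (.fn f ts) bs as (h ▸ hk) h.symm
      exact ⟨σ, h1.symm, fun τ' h' => h2 τ' h'.symm⟩
    simp only [List.map_cons, List.cons.injEq, subst_fn, fn.injEq, List.cons.sizeOf_spec,
      fn.sizeOf_spec] at hk h
    obtain ⟨⟨rfl, hts⟩, hs⟩ := h
    have hlen : ts.length = ss.length := by simpa using congrArg List.length hts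
    have sizeOf_append : ∀ cs ds : List (Tm F),
        sizeOf (cs ++ ds) + 1 = sizeOf cs + sizeOf ds := by
      intro cs ds
      induction cs with
      | nil => simp; omega
      | cons c cs ih => simp; omega
    have := sizeOf_append (ts.map (subst τ)) (as.map (subst τ))
    obtain ⟨σ, h1, h2⟩ := ih (ts ++ as) (ss ++ bs)
      (by rw [List.map_append]; omega) (by simp only [List.map_append, hts, hs])
    refine ⟨σ, ?_, fun τ' h' => h2 τ' ?_⟩
    · simp only [List.map_append] at h1
      have := List.append_inj h1 (by simpa using hlen)
      simp [this]
    · simp at h'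
      simp [h']

theorem exists_mgu {τ : Nat → Tm F} {s t : Tm F} (h : Unifies τ s t) :
    ∃ σ, IsMGU σ s t := by
  obtain ⟨σ, h1, h2⟩ := exists_mgu_list τ _ [s] [t] le_rfl (by simpa [Unifies] using h)
  exact ⟨σ, by simpa [Unifies] using h1, fun τ' h' => h2 τ' (by simpa [Unifies] using h')⟩

@[simp] theorem subtermAt_nil (t : Tm F) : subtermAt t [] = some t := by
  simp [subtermAt]

@[simp] theorem replaceAt_nil (t s : Tm F) : replaceAt t [] s = some s := by
  simp [replaceAt]

@[simp] theorem subtermAt_var_cons (n i : Nat) (p : List Nat) :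
    subtermAt (.var n : Tm F) (i :: p) = none := by
  simp [subtermAt]

@[simp] theorem replaceAt_var_cons (n i : Nat) (p : List Nat) (s : Tm F) :
    replaceAt (.var n : Tm F) (i :: p) s = none := by
  simp [replaceAt]

theorem subtermAt_fn_cons {f : F} {ts : List (Tm F)} {i : Nat} {p : List Nat} {v : Tm F} :
    subtermAt (.fn f ts) (i :: p) = some v ↔
      ∃ u, ts[i]? = some u ∧ subtermAt u p = some v := by
  rw [subtermAt]
  cases ts[i]? <;> simp

theorem replaceAt_fn_cons {f : F} {ts : List (Tm F)} {i : Nat} {p : List Nat} {s t : Tm F} :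
    replaceAt (.fn f ts) (i :: p) s = some t ↔
      ∃ u u', ts[i]? = some u ∧ replaceAt u p s = some u' ∧ .fn f (ts.set i u') = t := by
  rw [replaceAt]
  cases ts[i]? <;> simp

theorem subtermAt_append {p q : List Nat} {t v : Tm F} :
    subtermAt t (p ++ q) = some v ↔
      ∃ u, subtermAt t p = some u ∧ subtermAt u q = some v := by
  induction p generalizing t with
  | nil => simp
  | cons i p ih =>
    cases t with
    | var n => simp
    | fn f ts =>
      simp only [List.cons_append, subtermAt_fn_cons, ih]
      grind

theorem replaceAt_append {p q : List Nat} {s t u v : Tm F} (hu : subtermAt t p = some u)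
    (h : replaceAt t (p ++ q) s = some v) :
    ∃ u', replaceAt u q s = some u' ∧ replaceAt t p u' = some v := by
  induction p generalizing t v with
  | nil => simp_all
  | cons i p ih =>
    cases t with
    | var n => simp at hu
    | fn f ts =>
      obtain ⟨w, hw, hu⟩ := subtermAt_fn_cons.1 hu
      obtain ⟨w', w'', hw', h, rfl⟩ := replaceAt_fn_cons.1 h
      obtain rfl : w = w' := by simpa [hw] using hw'
      obtain ⟨u', h1, h2⟩ := ih hu h
      exact ⟨u', h1, replaceAt_fn_cons.2 ⟨w, w'', hw, h2, rfl⟩⟩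

theorem exists_replaceAt {p : List Nat} {t u : Tm F} (h : subtermAt t p = some u)
    (s : Tm F) : ∃ v, replaceAt t p s = some v := by
  induction p generalizing t with
  | nil => simp
  | cons i p ih =>
    cases t with
    | var n => simp at h
    | fn f ts =>
      obtain ⟨w, hw, h⟩ := subtermAt_fn_cons.1 h
      obtain ⟨v, hv⟩ := ih h
      exact ⟨_, replaceAt_fn_cons.2 ⟨w, v, hw, hv, rfl⟩⟩

theorem subtermAt_subst (σ : Nat → Tm F) {p : List Nat} {t v : Tm F}
    (h : subtermAt t p = some v) : subtermAt (subst σ t) p = some (subst σ v) := by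
  induction p generalizing t with
  | nil => simp_all
  | cons i p ih =>
    cases t with
    | var n => simp at h
    | fn f ts =>
      obtain ⟨w, hw, h⟩ := subtermAt_fn_cons.1 h
      rw [subst_fn]
      exact subtermAt_fn_cons.2 ⟨subst σ w, by simp [hw], ih h⟩

theorem replaceAt_subst (σ : Nat → Tm F) {p : List Nat} {s t v : Tm F}
    (h : replaceAt t p s = some v) :
    replaceAt (subst σ t) p (subst σ s) = some (subst σ v) := by
  induction p generalizing t v with
  | nil => simp_all
  | cons i p ih =>
    cases t with
    | var n => simp at h
    | fn f ts =>
      obtain ⟨w, w', hw, hw', rfl⟩ := replaceAt_fn_cons.1 h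
      rw [subst_fn, subst_fn]
      exact replaceAt_fn_cons.2 ⟨subst σ w, subst σ w', by simp [hw], ih hw',
        by simp [List.map_set]⟩

/-- A position of an instance of `t` is a function position of `t`, or lies inside the
substitution at some variable of `t`. -/
theorem subtermAt_subst_cases {σ : Nat → Tm F} {p : List Nat} {t w : Tm F}
    (h : subtermAt (subst σ t) p = some w) :
    (∃ f ts, subtermAt t p = some (.fn f ts)) ∨
      ∃ p₁ p₂ x, p = p₁ ++ p₂ ∧ subtermAt t p₁ = some (.var x) ∧
        subtermAt (σ x) p₂ = some w := by
  induction p generalizing t with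
  | nil =>
    cases t with
    | var n => exact .inr ⟨[], [], n, by simp_all⟩
    | fn f ts => exact .inl ⟨f, ts, by simp⟩
  | cons i p ih =>
    cases t with
    | var n => exact .inr ⟨[], i :: p, n, by simp_all⟩
    | fn f ts =>
      rw [subst_fn] at h
      obtain ⟨u, hu, h⟩ := subtermAt_fn_cons.1 h
      rw [List.getElem?_map, Option.map_eq_some_iff] at hu
      obtain ⟨t, ht, rfl⟩ := hu
      rcases ih h with ⟨g, ss, h⟩ | ⟨p₁, p₂, x, rfl, h1, h2⟩
      · exact .inl ⟨g, ss, subtermAt_fn_cons.2 ⟨t, ht, h⟩⟩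
      · exact .inr ⟨i :: p₁, p₂, x, rfl, subtermAt_fn_cons.2 ⟨t, ht, h1⟩, h2⟩

end Tm

section Rewriting

variable {F : Type} {R : TRS F}

open Relation

/-- A rewrite step at a given position. -/
def RewAt (R : TRS F) (p : List Nat) (s t : Tm F) : Prop :=
  ∃ l r σ, (l, r) ∈ R ∧ subtermAt s p = some (subst σ l) ∧
    replaceAt s p (subst σ r) = some t

theorem RewAt.rew {p : List Nat} {s t : Tm F} (h : RewAt R p s t) : Rew R s t := ⟨p, h⟩

theorem RewAt.subtermAt_reducible {p : List Nat} {s t : Tm F} (h : RewAt R p s t) :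
    ∃ v w, subtermAt s p = some v ∧ Rew R v w := by
  obtain ⟨l, r, σ, hR, h1, -⟩ := h
  exact ⟨_, subst σ r, h1, [], l, r, σ, hR, by simp, by simp⟩

theorem rewAt_cons {f : F} {ts : List (Tm F)} {i : Nat} {p : List Nat} {t : Tm F} :
    RewAt R (i :: p) (.fn f ts) t ↔
      ∃ u u', ts[i]? = some u ∧ RewAt R p u u' ∧ .fn f (ts.set i u') = t := by
  constructor
  · rintro ⟨l, r, σ, hR, h1, h2⟩
    obtain ⟨u, hu, h1⟩ := subtermAt_fn_cons.1 h1
    obtain ⟨v, v', hv, h2, rfl⟩ := replaceAt_fn_cons.1 h2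
    obtain rfl : u = v := by simpa [hu] using hv
    exact ⟨u, v', hu, ⟨l, r, σ, hR, h1, h2⟩, rfl⟩
  · rintro ⟨u, u', hu, ⟨l, r, σ, hR, h1, h2⟩, rfl⟩
    exact ⟨l, r, σ, hR, subtermAt_fn_cons.2 ⟨u, hu, h1⟩,
      replaceAt_fn_cons.2 ⟨u, u', hu, h2, rfl⟩⟩

theorem Rew.fn_set {f : F} {ts : List (Tm F)} {i : Nat} {u u' : Tm F}
    (hu : ts[i]? = some u) (h : Rew R u u') : Rew R (.fn f ts) (.fn f (ts.set i u')) := by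
  obtain ⟨p, h⟩ := h
  exact (rewAt_cons.2 ⟨u, u', hu, h, rfl⟩ : RewAt R (i :: p) _ _).rew

theorem reflTransGen_fn_set (f : F) {ts : List (Tm F)} {i : Nat} (hi : i < ts.length)
    {u v : Tm F} (h : ReflTransGen (Rew R) u v) :
    ReflTransGen (Rew R) (.fn f (ts.set i u)) (.fn f (ts.set i v)) := by
  refine h.lift (fun u => Tm.fn f (ts.set i u)) (fun a b hab => ?_)
  have := Rew.fn_set (f := f) (ts := ts.set i a) (i := i) (by simp [hi]) hab
  simpa using this

theorem reflTransGen_fn (f : F) {as bs : List (Tm F)}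
    (h : List.Forall₂ (ReflTransGen (Rew R)) as bs) :
    ReflTransGen (Rew R) (.fn f as) (.fn f bs) := by
  suffices ∀ pre : List (Tm F),
      ReflTransGen (Rew R) (.fn f (pre ++ as)) (.fn f (pre ++ bs)) from this []
  induction h with
  | nil => exact fun pre => .refl
  | @cons a b as bs hab _ ih =>
    intro pre
    have h1 := reflTransGen_fn_set f (ts := pre ++ a :: as) (i := pre.length) (by simp) hab
    have h2 := ih (pre ++ [b])
    simp at h1 h2
    exact h1.trans h2

theorem Joinable.fn_set (f : F) {ts : List (Tm F)} {i : Nat} (hi : i < ts.length)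
    {u v : Tm F} (h : Joinable R u v) :
    Joinable R (.fn f (ts.set i u)) (.fn f (ts.set i v)) := by
  obtain ⟨w, h1, h2⟩ := h
  exact ⟨_, reflTransGen_fn_set f hi h1, reflTransGen_fn_set f hi h2⟩

theorem Joinable.symm {s t : Tm F} (h : Joinable R s t) : Joinable R t s := by
  obtain ⟨v, h1, h2⟩ := h
  exact ⟨v, h2, h1⟩

theorem Rew.subst (δ : Nat → Tm F) {s t : Tm F} (h : Rew R s t) :
    Rew R (subst δ s) (subst δ t) := by
  obtain ⟨p, l, r, σ, hR, h1, h2⟩ := h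
  refine ⟨p, l, r, fun n => Tm.subst δ (σ n), hR, ?_, ?_⟩
  · rw [← subst_subst]; exact subtermAt_subst δ h1
  · rw [← subst_subst]; exact replaceAt_subst δ h2

theorem Joinable.subst (δ : Nat → Tm F) {s t : Tm F} (h : Joinable R s t) :
    Joinable R (subst δ s) (subst δ t) := by
  obtain ⟨v, h1, h2⟩ := h
  exact ⟨Tm.subst δ v, h1.lift (Tm.subst δ) fun _ _ => Rew.subst δ,
    h2.lift (Tm.subst δ) fun _ _ => Rew.subst δ⟩

theorem reflTransGen_subst {σ σ' : Nat → Tm F} (h : ∀ n, ReflTransGen (Rew R) (σ n) (σ' n))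
    (t : Tm F) : ReflTransGen (Rew R) (subst σ t) (subst σ' t) := by
  induction t using ind with
  | hvar n => simpa using h n
  | hfn f ts ih =>
    rw [subst_fn, subst_fn]
    refine reflTransGen_fn f ?_
    rw [List.forall₂_map_left_iff, List.forall₂_map_right_iff, List.forall₂_same]
    exact ih

theorem reflTransGen_replaceAt_subst {σ σ' : Nat → Tm F}
    (h : ∀ n, ReflTransGen (Rew R) (σ n) (σ' n)) {p : List Nat} {x : Nat} {l t : Tm F}
    (hx : subtermAt l p = some (.var x)) (ht : replaceAt (subst σ l) p (σ' x) = some t) :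
    ReflTransGen (Rew R) t (subst σ' l) := by
  induction p generalizing l t with
  | nil =>
    obtain rfl : l = .var x := by simpa using hx
    obtain rfl : σ' x = t := by simpa using ht
    simpa using ReflTransGen.refl
  | cons i p ih =>
    cases l with
    | var n => simp at hx
    | fn f ts =>
      rw [subst_fn] at ht
      obtain ⟨u, hu, hx⟩ := subtermAt_fn_cons.1 hx
      obtain ⟨v, v', hv, ht, rfl⟩ := replaceAt_fn_cons.1 ht
      obtain rfl : subst σ u = v := by simpa [hu] using hv
      rw [subst_fn]
      refine reflTransGen_fn f (List.forall₂_iff_get.2 ⟨by simp, fun j h1 h2 => ?_⟩)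
      simp only [List.get_eq_getElem, List.getElem_map, List.getElem_set]
      split_ifs with hij
      · subst hij
        have : ts[i]'(by simpa using h2) = u := by
          rw [List.getElem?_eq_some_iff] at hu; exact hu.2
        rw [this]
        exact ih hx ht
      · exact reflTransGen_subst h _

theorem CriticalPeak.rew {p : List Nat} {s t u : Tm F} (h : CriticalPeak R R t p s u) :
    Rew R s t ∧ Rew R s u := by
  obtain ⟨l₁, r₁, l₂, r₂, σ, ⟨⟨a, b⟩, hq₁, ρ₁, rfl, rfl⟩, ⟨⟨c, d⟩, hq₂, ρ₂, rfl, rfl⟩, -,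
    ⟨f, ts, hp, hσ, -⟩, -, rfl, ht, rfl⟩ := h
  refine ⟨⟨p, a, b, fun n => σ (ρ₁ n), hq₁, ?_, ?_⟩,
    ⟨[], c, d, fun n => σ (ρ₂ n), hq₂, ?_, ?_⟩⟩
  · rw [← subst_rename, hσ]; exact subtermAt_subst σ hp
  · rw [← subst_rename]; exact ht
  · rw [← subst_rename]; simp
  · rw [← subst_rename]; simp

theorem VariantRule.refl (q : Tm F × Tm F) : VariantRule q q :=
  ⟨Equiv.refl _, by simp [rename, subst_var_eq], by simp [rename, subst_var_eq]⟩

/-- Two rules can be renamed apart, and instances of both can then be given by a single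
substitution. -/
theorem exists_disjoint_variant (l₁ r₁ l₂ r₂ : Tm F) (σ₁ σ₂ : Nat → Tm F) :
    ∃ (ρ : Nat ≃ Nat) (τ : Nat → Tm F),
      (vars (rename ρ l₁) ∪ vars (rename ρ r₁)) ∩ (vars l₂ ∪ vars r₂) = ∅ ∧
      subst τ (rename ρ l₁) = subst σ₁ l₁ ∧ subst τ (rename ρ r₁) = subst σ₁ r₁ ∧
      ∀ n ∈ vars l₂ ∪ vars r₂, τ n = σ₂ n := by
  obtain ⟨N₁, h₁⟩ := exists_vars_bound l₁
  obtain ⟨N₂, h₂⟩ := exists_vars_bound r₁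
  obtain ⟨N₃, h₃⟩ := exists_vars_bound l₂
  obtain ⟨N₄, h₄⟩ := exists_vars_bound r₂
  set N := N₁ + N₂ + N₃ + N₄
  have hl₁ : ∀ n ∈ vars l₁, n < N := fun n hn => by have := h₁ n hn; omega
  have hr₁ : ∀ n ∈ vars r₁, n < N := fun n hn => by have := h₂ n hn; omega
  have h₂' : ∀ n ∈ vars l₂ ∪ vars r₂, n < N := by
    rintro n (hn | hn)
    · have := h₃ n hn; omega
    · have := h₄ n hn; omega
  let g : Nat → Nat := fun n => if n < N then n + N else if n < 2 * N then n - N else n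
  have hg : Function.Involutive g := by
    intro n
    simp only [g]
    grind
  have hgN : ∀ n, n < N → ¬ g n < N := fun n hn => by simp [g, hn]
  refine ⟨hg.toPerm g, fun n => if n < N then σ₂ n else σ₁ (g n), ?_, ?_, ?_, ?_⟩
  · ext n
    simp only [Set.mem_inter_iff, Set.mem_empty_iff_false, iff_false, not_and]
    intro hn hn'
    have hnN := h₂' n hn'
    rcases hn with hn | hn
    · obtain ⟨m, hm, rfl⟩ := mem_vars_rename.1 hn
      exact hgN m (hl₁ m hm) hnN
    · obtain ⟨m, hm, rfl⟩ := mem_vars_rename.1 hn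
      exact hgN m (hr₁ m hm) hnN
  · rw [subst_rename, subst_eq_subst_iff]
    intro n hn
    simp [hgN n (hl₁ n hn), hg n]
  · rw [subst_rename, subst_eq_subst_iff]
    intro n hn
    simp [hgN n (hr₁ n hn), hg n]
  · intro n hn
    simp [h₂' n hn]

theorem joinable_of_primeAt_of_root (hTRS : IsTRS R)
    (hPCP : ∀ tu ∈ PCP R, Joinable R tu.1 tu.2) {p : List Nat} {l r t : Tm F}
    {σ : Nat → Tm F} (hR : (l, r) ∈ R) (hp : PrimeAt R (subst σ l) p)
    (ht : RewAt R p (subst σ l) t) : Joinable R t (subst σ r) := by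
  obtain ⟨l₁, r₁, σ₁, hR₁, h1, h2⟩ := ht
  rcases subtermAt_subst_cases h1 with ⟨f, ts, hf⟩ | ⟨p₁, p₂, x, rfl, hx, hσx⟩
  · obtain ⟨ρ, τ, hdisj, hl, hr, hτ⟩ := exists_disjoint_variant l₁ r₁ l r σ₁ σ
    have hτl : subst σ l = subst τ l :=
      subst_eq_subst_iff.2 fun n hn => (hτ n (.inl hn)).symm
    have hτr : subst σ r = subst τ r :=
      subst_eq_subst_iff.2 fun n hn => (hτ n (.inr hn)).symm
    rw [hτl] at hp h1 h2
    rw [← hl, subtermAt_subst τ hf, Option.some_inj] at h1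
    rw [← hr] at h2
    rw [hτr]
    by_cases hvar : p = [] ∧ VariantRule (rename ρ l₁, rename ρ r₁) (l, r)
    · obtain ⟨rfl, π, hπl, hπr⟩ := hvar
      simp only at hπl hπr
      rw [subtermAt_nil, Option.some_inj] at hf
      rw [← hf] at h1
      rw [replaceAt_nil, Option.some_inj] at h2
      have hvars : vars (rename ρ r₁) ⊆ vars (rename ρ l₁) := by
        intro n hn
        obtain ⟨m, hm, rfl⟩ := mem_vars_rename.1 hn
        exact mem_vars_rename.2 ⟨m, (hTRS _ hR₁).2 hm, rfl⟩
      have : t = subst τ r := by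
        rw [← h2, ← hπr, subst_rename τ π]
        rw [← hπl, subst_rename τ π, eq_comm] at h1
        exact subst_eq_subst_iff.2 fun n hn => subst_eq_subst_iff.1 h1 n (hvars hn)
      rw [this]
      exact ⟨_, .refl, .refl⟩
    · obtain ⟨μ, hμ⟩ := exists_mgu (τ := τ) h1.symm
      obtain ⟨δ, hδ⟩ := hμ.2 τ h1.symm
      have hτμ : ∀ w, subst τ w = subst δ (subst μ w) := fun w => by
        rw [subst_subst, ← funext hδ]
      obtain ⟨t₀, ht₀⟩ := exists_replaceAt (subtermAt_subst μ hf) (subst μ (rename ρ r₁))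
      have hmem : (t₀, subst μ r) ∈ PCP R := by
        refine ⟨p, subst μ l, ⟨_, _, l, r, μ, ⟨_, hR₁, ρ, rfl, rfl⟩,
          ⟨_, hR, VariantRule.refl _⟩, hdisj, ⟨f, ts, hf, hμ⟩, fun h h' => hvar ⟨h, h'⟩,
          rfl, ht₀, rfl⟩, fun q v hq hv b hb => ?_⟩
        refine hp q (subst δ v) hq ?_ _ (hb.subst δ)
        rw [hτμ]
        exact subtermAt_subst δ hv
      have hjoin := (hPCP _ hmem).subst δ
      have := replaceAt_subst δ ht₀
      rw [← hτμ, ← hτμ, h2, Option.some_inj] at this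
      simp only [← hτμ, ← this] at hjoin
      exact hjoin
  · obtain ⟨u', hu', h2⟩ := replaceAt_append (subtermAt_subst σ hx) h2
    rw [subst_var] at hu'
    set σ' := Function.update σ x u' with hσ'
    have hstep : ∀ n, ReflTransGen (Rew R) (σ n) (σ' n) := by
      intro n
      by_cases hn : n = x
      · subst hn
        rw [hσ', Function.update_self]
        exact .single ⟨p₂, l₁, r₁, σ₁, hR₁, hσx, hu'⟩
      · rw [hσ', Function.update_of_ne hn]
    refine ⟨subst σ' r, ?_, reflTransGen_subst hstep r⟩
    refine (reflTransGen_replaceAt_subst hstep hx (by simpa [hσ'] using h2)).tail ?_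
    exact ⟨[], l, r, σ', hR, by simp, by simp⟩

theorem primeAt_cons {f : F} {ts : List (Tm F)} {i : Nat} {p : List Nat} {u : Tm F}
    (hu : ts[i]? = some u) : PrimeAt R (.fn f ts) (i :: p) ↔ PrimeAt R u p := by
  simp [PrimeAt, subtermAt_fn_cons, hu]

theorem joinable_of_primeAt (hTRS : IsTRS R)
    (hPCP : ∀ tu ∈ PCP R, Joinable R tu.1 tu.2) {p q : List Nat} {s t u : Tm F}
    (hp : PrimeAt R s p) (ht : RewAt R p s t) (hu : RewAt R q s u) : Joinable R t u := by
  induction q generalizing p s t u with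
  | nil =>
    obtain ⟨l, r, σ, hR, h1, h2⟩ := hu
    obtain rfl : s = subst σ l := by simpa using h1
    obtain rfl : subst σ r = u := by simpa using h2
    exact joinable_of_primeAt_of_root hTRS hPCP hR hp ht
  | cons j q ih =>
    rcases p with _ | ⟨i, p⟩
    · obtain ⟨v, w, hv, hw⟩ := hu.subtermAt_reducible
      exact absurd hw (hp (j :: q) v (by simp) (by simpa using hv) w)
    · rcases s with n | ⟨f, ts⟩
      · obtain ⟨l, r, σ, -, h1, -⟩ := hu
        simp at h1
      · obtain ⟨a, a', ha, hat, rfl⟩ := rewAt_cons.1 ht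
        obtain ⟨b, b', hb, hbu, rfl⟩ := rewAt_cons.1 hu
        by_cases hij : i = j
        · subst hij
          obtain rfl : a = b := by simpa [ha] using hb
          obtain ⟨hi, -⟩ := List.getElem?_eq_some_iff.1 ha
          exact (ih ((primeAt_cons ha).1 hp) hat hbu).fn_set f hi
        · refine ⟨.fn f ((ts.set i a').set j b'), .single ?_, .single ?_⟩
          · exact Rew.fn_set (by rw [List.getElem?_set_ne hij, hb]) hbu.rew
          · rw [List.set_comm _ _ hij]
            exact Rew.fn_set (by rw [List.getElem?_set_ne (Ne.symm hij), ha]) hat.rew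

theorem Rew.of_subtermAt {p : List Nat} {s v w : Tm F} (hv : subtermAt s p = some v)
    (h : Rew R v w) : ∃ t, Rew R s t := by
  obtain ⟨q, l, r, σ, hR, h1, -⟩ := h
  have h := subtermAt_append.2 ⟨v, hv, h1⟩
  obtain ⟨t, ht⟩ := exists_replaceAt h (Tm.subst σ r)
  exact ⟨t, p ++ q, l, r, σ, hR, h, ht⟩

/-- Every reducible term admits a step all of whose proper subterms are normal forms. -/
theorem exists_primeAt_rewAt {s t : Tm F} (h : Rew R s t) :
    ∃ p v, PrimeAt R s p ∧ RewAt R p s v := by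
  induction s using ind generalizing t with
  | hvar n =>
    obtain ⟨p, h⟩ := h
    refine ⟨p, t, fun q v hq hv => ?_, h⟩
    cases hpq : p ++ q with
    | nil => simp_all
    | cons i p' => simp [hpq] at hv
  | hfn f ts ih =>
    by_cases hts : ∃ (i : Nat) (u w : Tm F), ts[i]? = some u ∧ Rew R u w
    · obtain ⟨i, u, w, hu, hw⟩ := hts
      obtain ⟨p, v, hp, hv⟩ := ih u (List.mem_of_getElem? hu) hw
      exact ⟨i :: p, _, (primeAt_cons hu).2 hp, rewAt_cons.2 ⟨u, v, hu, hv, rfl⟩⟩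
    · obtain ⟨_ | ⟨i, p⟩, h⟩ := h
      · refine ⟨[], t, fun q v hq hv b hb => ?_, h⟩
        rcases q with _ | ⟨i, q⟩
        · exact hq rfl
        · obtain ⟨u, hu, hv⟩ := subtermAt_fn_cons.1 (by simpa using hv)
          obtain ⟨w, hw⟩ := Rew.of_subtermAt hv hb
          exact hts ⟨i, u, w, hu, hw⟩
      · obtain ⟨u, u', hu, h, -⟩ := (rewAt_cons (R := R)).1 h
        exact absurd ⟨i, u, u', hu, h.rew⟩ hts

theorem confluent_of_joinable_pcp (hTRS : IsTRS R) (hterm : Terminating R)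
    (hPCP : ∀ tu ∈ PCP R, Joinable R tu.1 tu.2) : Confluent R := by
  intro s
  induction s using hterm.induction with
  | _ s ih =>
    intro t u ht hu
    rcases ht.cases_head with rfl | ⟨a, ha, hat⟩
    · exact ⟨u, hu, .refl⟩
    rcases hu.cases_head with rfl | ⟨b, hb, hbu⟩
    · exact ⟨t, .refl, ht⟩
    obtain ⟨p, v, hp, hv⟩ := exists_primeAt_rewAt ha
    obtain ⟨c, hac, hvc⟩ :=
      (joinable_of_primeAt hTRS hPCP hp hv ha.choose_spec).symm
    obtain ⟨d, hvd, hbd⟩ := joinable_of_primeAt hTRS hPCP hp hv hb.choose_spec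
    obtain ⟨e, hce, hde⟩ := ih v hv.rew c d hvc hvd
    obtain ⟨g, htg, heg⟩ := ih a ha t e hat (hac.trans hce)
    obtain ⟨k, hgk, huk⟩ := ih b hb g u ((hbd.trans hde).trans heg) hbu
    exact ⟨k, htg.trans hgk, huk⟩

end Rewriting

/-- Kapur–Musser–Narendran: a terminating TRS is confluent if and only if
all its prime critical pairs are joinable. -/
theorem stmt4 {F : Type} (R : TRS F) (hTRS : IsTRS R) (hterm : Terminating R) :
    Confluent R ↔ ∀ tu ∈ PCP R, Joinable R tu.1 tu.2 := by
  constructor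
  · rintro hconf tu ⟨p, s, hpeak, -⟩
    obtain ⟨ht, hu⟩ := hpeak.rew
    exact hconf s _ _ (.single ht) (.single hu)
  · exact confluent_of_joinable_pcp hTRS hterm
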